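/- Let k be a field, (V,Q) a finite-dimensional symplectic vector space over k, and θ a self-adjoint endomorphism of V with θ^n = 0 and θ^{n−1} ≠ 0. Then C^l(V)^⊥ = C^{−l−1}(V) for all l with −n ≤ l ≤ n−1. -/

import Mathlib

/-- The orthogonal complement of a subspace with respect to a bilinear form. -/
def perpBilin {k V : Type*} [Field k] [AddCommGroup V] [Module k V]
    (Q : V →ₗ[k] V →ₗ[k] k) (W : Submodule k V) : Submodule k V :=
  ⨅ (w : V) (_ : w ∈ W), LinearMap.ker (Q.flip w)

/-- For a nilpotent endomorphism `θ` with `θ^n = 0`, the canonical filtration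
`C^l(V) = Σ_{i-j = l, 0 ≤ i ≤ n, 1 ≤ j ≤ n+1} ker(θ^i) ∩ im(θ^{j-1})`. -/
def Cfilt {k V : Type*} [Field k] [AddCommGroup V] [Module k V]
    (θ : V →ₗ[k] V) (n : ℕ) (l : ℤ) : Submodule k V :=
  ⨆ (p : ℕ × ℕ) (_ : (p.1 : ℤ) - (p.2 : ℤ) = l ∧ p.1 ≤ n ∧ 1 ≤ p.2 ∧ p.2 ≤ n + 1),
    LinearMap.ker (θ ^ p.1) ⊓ LinearMap.range (θ ^ (p.2 - 1))

/-- In a modular lattice, if `x ≤ a t ⊔ b t` for all `t`, with `a` increasing and `b` decreasing,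
then `x` is bounded by `a 0 ⊔ (b 0 ⊓ a 1) ⊔ ⋯ ⊔ (b (r - 1) ⊓ a r) ⊔ b r`. -/
theorem le_sup_of_forall_le_sup {α : Type*} [Lattice α] [IsModularLattice α]
    {a b : ℕ → α} (ha : Monotone a) (hb : Antitone b) {x S : α}
    (hx : ∀ t, x ≤ a t ⊔ b t) (h₀ : a 0 ≤ S) (hS : ∀ t, b t ⊓ a (t + 1) ≤ S) (r : ℕ) :
    x ≤ S ⊔ b r := by
  suffices h : ∃ s, s ≤ S ∧ s ≤ a r ∧ x ≤ s ⊔ b r by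
    obtain ⟨s, hs, -, hxs⟩ := h
    exact hxs.trans (sup_le_sup_right hs _)
  induction r with
  | zero => exact ⟨a 0, h₀, le_rfl, hx 0⟩
  | succ r ih =>
    obtain ⟨s, hs, hsa, hxs⟩ := ih
    have hsa' : s ≤ a (r + 1) := hsa.trans (ha r.le_succ)
    have hb' : b (r + 1) ≤ s ⊔ b r := (hb r.le_succ).trans le_sup_right
    refine ⟨s ⊔ b r ⊓ a (r + 1), sup_le hs (hS r), sup_le hsa' inf_le_right, ?_⟩
    calc x ≤ (s ⊔ b r) ⊓ (a (r + 1) ⊔ b (r + 1)) := le_inf hxs (hx _)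
      _ = (s ⊔ b r) ⊓ a (r + 1) ⊔ b (r + 1) := (inf_sup_assoc_of_le _ hb').symm
      _ = s ⊔ b r ⊓ a (r + 1) ⊔ b (r + 1) := by rw [sup_inf_assoc_of_le _ hsa']

section

variable {k V : Type*} [Field k] [AddCommGroup V] [Module k V]

theorem mem_perpBilin {Q : V →ₗ[k] V →ₗ[k] k} {W : Submodule k V} {x : V} :
    x ∈ perpBilin Q W ↔ ∀ w ∈ W, Q x w = 0 := by
  simp [perpBilin]

theorem perpBilin_anti (Q : V →ₗ[k] V →ₗ[k] k) {W W' : Submodule k V} (h : W ≤ W') :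
    perpBilin Q W' ≤ perpBilin Q W := fun _ hx =>
  mem_perpBilin.2 fun w hw => mem_perpBilin.1 hx w (h hw)

theorem perpBilin_sup (Q : V →ₗ[k] V →ₗ[k] k) (W W' : Submodule k V) :
    perpBilin Q (W ⊔ W') = perpBilin Q W ⊓ perpBilin Q W' := by
  refine le_antisymm
    (le_inf (perpBilin_anti Q le_sup_left) (perpBilin_anti Q le_sup_right)) ?_
  rintro x ⟨hx, hx'⟩
  refine mem_perpBilin.2 fun w hw => ?_
  obtain ⟨y, hy, z, hz, rfl⟩ := Submodule.mem_sup.1 hw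
  rw [map_add, mem_perpBilin.1 hx y hy, mem_perpBilin.1 hx' z hz, add_zero]

theorem perpBilin_perpBilin [FiniteDimensional k V] {Q : V →ₗ[k] V →ₗ[k] k}
    (halt : Q.IsAlt) (hinj : Function.Injective Q) (W : Submodule k V) :
    perpBilin Q (perpBilin Q W) = W := by
  have hperp (U : Submodule k V) : perpBilin Q U = LinearMap.BilinForm.orthogonal Q U := by
    ext x
    rw [mem_perpBilin, LinearMap.BilinForm.mem_orthogonal_iff]
    exact forall₂_congr fun w _ => halt.isRefl.eq_iff
  have hnd : LinearMap.BilinForm.Nondegenerate Q :=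
    halt.isRefl.nondegenerate_iff_separatingLeft.2
      (LinearMap.separatingLeft_iff_ker_eq_bot.2 (LinearMap.ker_eq_bot.2 hinj))
  rw [hperp, hperp, LinearMap.BilinForm.orthogonal_orthogonal hnd halt.isRefl]

theorem apply_pow_right_eq {Q : V →ₗ[k] V →ₗ[k] k} {θ : V →ₗ[k] V}
    (hsa : ∀ x y : V, Q (θ x) y + Q x (θ y) = 0) (m : ℕ) (x y : V) :
    Q x ((θ ^ m) y) = (-1) ^ m * Q ((θ ^ m) x) y := by
  induction m generalizing x with
  | zero => simp
  | succ m ih =>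
    rw [pow_succ', Module.End.mul_apply, eq_neg_of_add_eq_zero_right (hsa x _), ih,
      ← Module.End.mul_apply, ← pow_succ, ← pow_succ']
    ring

theorem perpBilin_range_pow {Q : V →ₗ[k] V →ₗ[k] k} (hinj : Function.Injective Q)
    {θ : V →ₗ[k] V} (hsa : ∀ x y : V, Q (θ x) y + Q x (θ y) = 0) (m : ℕ) :
    perpBilin Q (LinearMap.range (θ ^ m)) = LinearMap.ker (θ ^ m) := by
  ext x
  rw [mem_perpBilin, LinearMap.mem_ker, ← map_eq_zero_iff Q hinj, LinearMap.ext_iff]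
  simp [apply_pow_right_eq hsa]

theorem perpBilin_ker_inf_range [FiniteDimensional k V] {Q : V →ₗ[k] V →ₗ[k] k}
    (halt : Q.IsAlt) (hinj : Function.Injective Q) {θ : V →ₗ[k] V}
    (hsa : ∀ x y : V, Q (θ x) y + Q x (θ y) = 0) (i m : ℕ) :
    perpBilin Q (LinearMap.ker (θ ^ i) ⊓ LinearMap.range (θ ^ m)) =
      LinearMap.range (θ ^ i) ⊔ LinearMap.ker (θ ^ m) := by
  rw [← perpBilin_perpBilin halt hinj (LinearMap.range (θ ^ i) ⊔ LinearMap.ker (θ ^ m)),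
    perpBilin_sup, perpBilin_range_pow hinj hsa, ← perpBilin_range_pow hinj hsa m,
    perpBilin_perpBilin halt hinj]

theorem monotone_ker_pow (θ : V →ₗ[k] V) : Monotone fun i => LinearMap.ker (θ ^ i) :=
  monotone_nat_of_le_succ fun i => by
    rw [pow_succ']
    exact LinearMap.ker_le_ker_comp _ _

theorem antitone_range_pow (θ : V →ₗ[k] V) : Antitone fun i => LinearMap.range (θ ^ i) :=
  antitone_nat_of_succ_le fun i => by
    rw [pow_succ]
    exact LinearMap.range_comp_le_range _ _

/-- The bounds on the indices in the definition of `Cfilt` are immaterial for `l < n`. -/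
theorem ker_inf_range_le_Cfilt {θ : V →ₗ[k] V} {n : ℕ} (hnil : θ ^ n = 0) {l : ℤ} (hl : l < n)
    {i m : ℕ} (him : (i : ℤ) - m = l + 1) :
    LinearMap.ker (θ ^ i) ⊓ LinearMap.range (θ ^ m) ≤ Cfilt θ n l := by
  have key {i m : ℕ} (him : (i : ℤ) - m = l + 1) (hi : i ≤ n) (hm : m ≤ n) :
      LinearMap.ker (θ ^ i) ⊓ LinearMap.range (θ ^ m) ≤ Cfilt θ n l :=
    le_iSup₂_of_le (i, m + 1) ⟨by push_cast; lia, hi, by simp, by simpa using hm⟩ le_rfl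
  rcases le_or_gt n m with hm | hm
  · refine inf_le_right.trans ((antitone_range_pow θ hm).trans ?_)
    simp [hnil]
  · rcases le_or_gt i n with hi | hi
    · exact key him hi hm.le
    · refine le_trans (inf_le_inf ?_ (antitone_range_pow θ (Nat.sub_le m (i - n))))
        (key (i := n) (m := m - (i - n)) (by lia) le_rfl (by lia))
      simp [hnil]

theorem apply_eq_zero_of_mem_ker_inf_range {Q : V →ₗ[k] V →ₗ[k] k} (halt : Q.IsAlt) {θ : V →ₗ[k] V}
    (hsa : ∀ x y : V, Q (θ x) y + Q x (θ y) = 0) {i j m m' : ℕ} (h : i + j ≤ m + m' + 1)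
    {x y : V} (hx : x ∈ LinearMap.ker (θ ^ i) ⊓ LinearMap.range (θ ^ m))
    (hy : y ∈ LinearMap.ker (θ ^ j) ⊓ LinearMap.range (θ ^ m')) : Q x y = 0 := by
  have key {i m : ℕ} (him : i ≤ m) {x : V} (hx : x ∈ LinearMap.ker (θ ^ i)) (b : V) :
      Q x ((θ ^ m) b) = 0 := by
    rw [apply_pow_right_eq hsa, LinearMap.mem_ker.1 (monotone_ker_pow θ him hx)]
    simp
  obtain ⟨hx, a, rfl⟩ := hx
  obtain ⟨hy, b, rfl⟩ := hy
  rcases le_or_gt i m' with him | him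
  · exact key him hx b
  · exact halt.isRefl.eq_zero (key (by lia) hy a)

theorem Cfilt_le_perpBilin_Cfilt {Q : V →ₗ[k] V →ₗ[k] k} (halt : Q.IsAlt) {θ : V →ₗ[k] V}
    (hsa : ∀ x y : V, Q (θ x) y + Q x (θ y) = 0) (n : ℕ) (l : ℤ) :
    Cfilt θ n (-l - 1) ≤ perpBilin Q (Cfilt θ n l) := by
  refine iSup₂_le fun p hp x hx => mem_perpBilin.2 fun y hy => ?_
  suffices h : Cfilt θ n l ≤ LinearMap.ker (Q x) from h hy
  exact iSup₂_le fun q hq z hz => apply_eq_zero_of_mem_ker_inf_range halt hsa (by lia) hx hz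

theorem perpBilin_Cfilt_le_Cfilt [FiniteDimensional k V] {Q : V →ₗ[k] V →ₗ[k] k}
    (halt : Q.IsAlt) (hinj : Function.Injective Q) {θ : V →ₗ[k] V}
    (hsa : ∀ x y : V, Q (θ x) y + Q x (θ y) = 0) {n : ℕ} (hnil : θ ^ n = 0) {l : ℤ}
    (hl : -(n : ℤ) ≤ l) (hl' : l < n) :
    perpBilin Q (Cfilt θ n l) ≤ Cfilt θ n (-l - 1) := by
  let d := (-(l + 1)).toNat
  let e := (l + 1).toNat
  have hde : (e : ℤ) - d = l + 1 := by lia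
  have hle {i m : ℕ} (him : (i : ℤ) - m = -l) :
      LinearMap.ker (θ ^ i) ⊓ LinearMap.range (θ ^ m) ≤ Cfilt θ n (-l - 1) :=
    ker_inf_range_le_Cfilt hnil (by lia) (by lia)
  have h := le_sup_of_forall_le_sup (x := perpBilin Q (Cfilt θ n l)) (S := Cfilt θ n (-l - 1))
    (a := fun t => LinearMap.ker (θ ^ (d + t))) (b := fun t => LinearMap.range (θ ^ (e + t)))
    (fun _ _ h => monotone_ker_pow θ (Nat.add_le_add_left h d))
    (fun _ _ h => antitone_range_pow θ (Nat.add_le_add_left h e))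
    (fun t => by
      rw [sup_comm, ← perpBilin_ker_inf_range halt hinj hsa]
      exact perpBilin_anti Q (ker_inf_range_le_Cfilt hnil hl' (by push_cast; lia)))
    (by
      rcases Nat.eq_zero_or_pos d with hd | hd
      · simp [hd, Module.End.one_eq_id]
      · have he : e = 0 := by lia
        refine le_trans (le_inf (monotone_ker_pow θ d.le_succ) ?_)
          (hle (i := d + 1) (m := 0) (by push_cast; lia))
        simp [Module.End.one_eq_id])
    (fun t => by
      rw [inf_comm]
      exact hle (by push_cast; lia)) n
  have hbot : LinearMap.range (θ ^ (e + n)) = ⊥ := by simp [pow_add, hnil]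
  simpa [hbot] using h

end

/-- Let `(V,Q)` be a finite-dimensional symplectic vector space over a field `k` and `θ`
a self-adjoint endomorphism with `θ^n = 0` and `θ^{n-1} ≠ 0`.  Then
`C^l(V)^⊥ = C^{-l-1}(V)` for all `-n ≤ l ≤ n-1`. -/
theorem stmt_8 {k V : Type*} [Field k] [AddCommGroup V] [Module k V]
    [FiniteDimensional k V]
    (Q : V →ₗ[k] V →ₗ[k] k)
    (halt : ∀ x : V, Q x x = 0)
    (hnd : Function.Bijective fun x : V => Q x)
    (θ : V →ₗ[k] V)
    (hsa : ∀ x y : V, Q (θ x) y + Q x (θ y) = 0)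
    (n : ℕ) (hnil : θ ^ n = 0) (hnil' : θ ^ (n - 1) ≠ 0) :
    ∀ l : ℤ, -(n : ℤ) ≤ l → l ≤ (n : ℤ) - 1 →
      perpBilin Q (Cfilt θ n l) = Cfilt θ n (-l - 1) := by
  intro l hl hl'
  exact le_antisymm
    (perpBilin_Cfilt_le_Cfilt halt hnd.injective hsa hnil hl (Int.lt_of_le_sub_one hl'))
    (Cfilt_le_perpBilin_Cfilt halt hsa n l)
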